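/- Plücker-type quadratic relation, dual version (Theorem 4.2(2)): Let R be a commutative ring, N a positive integer, U an N×N upper unitriangular matrix over R, and r an integer. Let λ be a partition with ℓ(λ) + 1 ≤ r and λ_1 + 2 ≤ N − r, and write its conjugate as λ' = (m_1^{r_1} m_2^{r_2−r_1} ⋯ m_n^{r_n−r_{n−1}}) with m_1 > ⋯ > m_n > 0 and 0 < r_1 < ⋯ < r_n (so λ' and λ have n corners). Fix 1 ≤ d ≤ n and set ℓ := r_d (the d-th shortest row length of λ). Then S^{(r)}_{λ}(U) · S^{(r+1)}_{λ}(U) = S^{(r)}_{(λ'−(1^ℓ))'}(U) · S^{(r+1)}_{(λ'+(1^ℓ))'}(U) + Σ_{t=1}^{min(d, n−d+1)} (−1)^{t−1} Σ_{1 ≤ p_1 < ⋯ < p_t ≤ d, d ≤ q_t < ⋯ < q_1 ≤ n} S^{(r)}_{(add^{p_1,…,p_t}_{q_1,…,q_t}(λ'))'}(U) · S^{(r+1)}_{(rem^{p_1,…,p_t}_{q_1,…,q_t}(λ'))'}(U), where the operators add and rem are applied to λ' using its corner data and ν' denotes the conjugate partition. -/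

import Mathlib

open Matrix BigOperators Finset Filter

/-- Extend a `Fin N`-indexed matrix to `ℕ` indices by zero. -/
def matExt {R : Type*} [Zero R] {N : ℕ} (U : Matrix (Fin N) (Fin N) R) : ℕ → ℕ → R :=
  fun i j => if hi : i < N then (if hj : j < N then U ⟨i, hi⟩ ⟨j, hj⟩ else 0) else 0

/-- `U` is upper unitriangular. -/
def UpperUni {R : Type*} [Zero R] [One R] {N : ℕ} (U : Matrix (Fin N) (Fin N) R) : Prop :=
  (∀ i, U i i = 1) ∧ ∀ i j : Fin N, (j : ℕ) < (i : ℕ) → U i j = 0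

/-- `L` is lower unitriangular. -/
def LowerUni {R : Type*} [Zero R] [One R] {N : ℕ} (L : Matrix (Fin N) (Fin N) R) : Prop :=
  (∀ i, L i i = 1) ∧ ∀ i j : Fin N, (i : ℕ) < (j : ℕ) → L i j = 0

/-- 0-based entries of the Maya diagram `J(λ;r)` (the `a`-th smallest element, minus 1):
for `a = 0,…,r-1` this is `λ_{r-a} + a` (with `λ` 0-based). -/
def maya (lam : ℕ → ℕ) (r : ℕ) (a : Fin r) : ℕ := lam (r - 1 - (a : ℕ)) + (a : ℕ)

/-- The ninth variation of the skew Schur function `S^{(r)}_{λ/μ}(U)`: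
the minor of `U` on rows `J(μ;r)` and columns `J(λ;r)`. -/
def SchurV {R : Type*} [CommRing R] {N : ℕ} (U : Matrix (Fin N) (Fin N) R)
    (r : ℕ) (lam mu : ℕ → ℕ) : R :=
  Matrix.det (Matrix.of fun i j : Fin r => matExt U (maya mu r i) (maya lam r j))

/-- Conjugate partition (0-based), counting parts among indices `< B`. -/
def conjF (f : ℕ → ℕ) (B : ℕ) : ℕ → ℕ :=
  fun i => ((Finset.range B).filter fun j => i + 1 ≤ f j).card

/-- The hook partition `(a+1, 1^b)` (0-based function). -/
def hookP (a b : ℕ) : ℕ → ℕ := fun k => if k = 0 then a + 1 else if k ≤ b then 1 else 0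

/-- `h^{(r)}_d(U) = S^{(r)}_{(d)}(U)`, zero for `d < 0`. -/
def hSV {R : Type*} [CommRing R] {N : ℕ} (U : Matrix (Fin N) (Fin N) R) (r : ℕ) (d : ℤ) : R :=
  if 0 ≤ d then SchurV U r (fun k => if k = 0 then d.toNat else 0) (fun _ => 0) else 0

/-- `e^{(r)}_d(U) = S^{(r)}_{(1^d)}(U)`, zero for `d < 0`. -/
def eSV {R : Type*} [CommRing R] {N : ℕ} (U : Matrix (Fin N) (Fin N) R) (r : ℕ) (d : ℤ) : R :=
  if 0 ≤ d then SchurV U r (fun k => if k < d.toNat then 1 else 0) (fun _ => 0) else 0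

/-- The partition with Frobenius coordinates `(a|b)` (all 0-based as functions). -/
def frobP (p : ℕ) (a b : Fin p → ℕ) : ℕ → ℕ :=
  fun i => if h : i < p then a ⟨i, h⟩ + i + 1
    else (Finset.univ.filter fun j : Fin p => i < b j + (j : ℕ) + 1).card

/-- `f : ℕ → ℤ` is a partition of length `≤ B`. -/
def IsPartZ (B : ℕ) (f : ℕ → ℤ) : Prop :=
  (∀ i, f (i + 1) ≤ f i) ∧ (∀ i, 0 ≤ f i) ∧ (∀ i, B ≤ i → f i = 0)

/-- `lam/mu` is a skew partition (of length `≤ B`). -/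
def IsSkewZ (B : ℕ) (lam mu : ℕ → ℤ) : Prop :=
  IsPartZ B lam ∧ IsPartZ B mu ∧ ∀ i, mu i ≤ lam i

open Classical in
/-- `S^{(r)}_{λ/μ}(U)` with the convention that it is `0` if `λ/μ` is not a skew partition. -/
noncomputable def SchurVz {R : Type*} [CommRing R] {N : ℕ} (U : Matrix (Fin N) (Fin N) R)
    (r B : ℕ) (lam mu : ℕ → ℤ) : R :=
  if IsSkewZ B lam mu then SchurV U r (fun i => (lam i).toNat) (fun i => (mu i).toNat) else 0

open Classical in
/-- `S^{(r)}_{λ'/μ'}(U)` applied to the conjugates, with the zero convention. -/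
noncomputable def SchurVzConj {R : Type*} [CommRing R] {N : ℕ} (U : Matrix (Fin N) (Fin N) R)
    (r B : ℕ) (lam mu : ℕ → ℤ) : R :=
  if IsSkewZ B lam mu then
    SchurV U r (conjF (fun i => (lam i).toNat) B) (conjF (fun i => (mu i).toNat) B) else 0

/-- `lam/mu` is a skew partition (ℕ-valued version). -/
def IsSkewN (B : ℕ) (lam mu : ℕ → ℕ) : Prop :=
  (∀ i, lam (i + 1) ≤ lam i) ∧ (∀ i, mu (i + 1) ≤ mu i) ∧ (∀ i, mu i ≤ lam i) ∧
    (∀ i, B ≤ i → lam i = 0)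

open Classical in
noncomputable def SchurVn {R : Type*} [CommRing R] {N : ℕ} (U : Matrix (Fin N) (Fin N) R)
    (r B : ℕ) (lam mu : ℕ → ℕ) : R :=
  if IsSkewN B lam mu then SchurV U r lam mu else 0

/-- The rectangular partition `[m|n] = (n^m)`. -/
def rectP (m n : ℕ) : ℕ → ℕ := fun i => if i < m then n else 0

/-- `[m|n]^l = ((n+1)^l, n^{m-l})`. -/
def rectUpP (m n l : ℕ) : ℕ → ℕ := fun i => if i < l then n + 1 else if i < m then n else 0

/-- `[m|n]_k = (n^m, k)`. -/
def rectLowP (m n k : ℕ) : ℕ → ℕ := fun i => if i < m then n else if i = m then k else 0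

/-- `E + c·E_{t,t+1}` (indices 0-based). -/
def elemMat {R : Type*} [CommRing R] (N t : ℕ) (c : R) : Matrix (Fin N) (Fin N) R :=
  1 + Matrix.of (fun i j : Fin N => if (i : ℕ) = t ∧ (j : ℕ) = t + 1 then c else 0)

/-- `U = U_1 ⋯ U_M` with `U_k = (E + w_{k,1-r}E_{1,2}) ⋯ (E + w_{k,N-1-r}E_{N-1,N})`. -/
def UmatW {R : Type*} [CommRing R] (N M : ℕ) (r : ℤ) (w : ℕ → ℤ → R) :
    Matrix (Fin N) (Fin N) R :=
  ((List.range M).map fun k =>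
    ((List.range (N - 1)).map fun t => elemMat N t (w (k + 1) ((t : ℤ) + 1 - r))).prod).prod

/-- The partition `(m_1^{r_1} m_2^{r_2-r_1} ⋯ m_n^{r_n-r_{n-1}})` (corner data 0-based). -/
def stepPart (n : ℕ) (m rr : ℕ → ℕ) : ℕ → ℕ :=
  fun i =>
    if h : (((Finset.range n).filter fun j => i < rr j)).Nonempty then
      m (((Finset.range n).filter fun j => i < rr j).min' h)
    else 0

/-- `Add_{a,b}` (rows 1-based in `a`, `b`; the function argument is 0-based). -/
def AddOp (a b : ℕ) (k : ℕ → ℕ) : ℕ → ℕ := fun i =>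
  if i + 1 ≤ a then k i
  else if i + 1 = a + 1 then k (a - 1)
  else if i + 1 ≤ b + 1 then k (i - 1) + 1
  else k i

/-- `Rem_{a,b}`. -/
def RemOp (a b : ℕ) (k : ℕ → ℕ) : ℕ → ℕ := fun i =>
  if i + 1 < a then k i
  else if i + 1 ≤ b - 1 then k (i + 1) - 1
  else if i + 1 = b then k b
  else k i

/-- `op_{a 0, b 0} ∘ op_{a 1, b 1} ∘ ⋯ ∘ op_{a (t-1), b (t-1)}` applied to `k`. -/
def iterOp (op : ℕ → ℕ → (ℕ → ℕ) → ℕ → ℕ) (t : ℕ) (a b : ℕ → ℕ) (k : ℕ → ℕ) : ℕ → ℕ :=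
  (List.range t).foldr (fun i acc => op (a i) (b i) acc) k

/-- the `i`-th smallest element of a finite set of naturals (0-based). -/
def ascNth (s : Finset ℕ) (i : ℕ) : ℕ := (s.sort (· ≤ ·)).getD i 0

/-- The cells of the skew Young diagram `D(λ/μ)` (0-based, rows `< B`). -/
def cellsD (B : ℕ) (lam mu : ℕ → ℕ) : Finset (ℕ × ℕ) :=
  (Finset.range B ×ˢ Finset.range (lam 0 + 1)).filter fun p => mu p.1 ≤ p.2 ∧ p.2 < lam p.1

/-- Semistandardness: weakly increasing along rows, strictly increasing down columns. -/
def IsSSYT {M B : ℕ} {lam mu : ℕ → ℕ} (T : ↥(cellsD B lam mu) → Fin M) : Prop :=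
  (∀ c c' : ↥(cellsD B lam mu), c.val.1 = c'.val.1 → c.val.2 ≤ c'.val.2 → T c ≤ T c') ∧
  (∀ c c' : ↥(cellsD B lam mu), c.val.1 < c'.val.1 → c.val.2 = c'.val.2 → T c < T c')

open Classical in
/-- Sum over all semistandard tableaux of shape `λ/μ` with entries in `{1,…,M}` of
the product over cells `c` of `f (entry) c`. -/
noncomputable def tabSum {R : Type*} [CommRing R] (M B : ℕ) (lam mu : ℕ → ℕ)
    (f : ℕ → ℕ × ℕ → R) : R :=
  ∑ T ∈ Finset.univ.filter (fun T : ↥(cellsD B lam mu) → Fin M => IsSSYT T),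
    ∏ c : ↥(cellsD B lam mu), f ((T c : ℕ) + 1) c.val

/-- `M`-truncated Schur multiple zeta value for a general filling `s` of the diagram. -/
noncomputable def zetaTF (M B : ℕ) (lam mu : ℕ → ℕ) (s : ℕ × ℕ → ℂ) : ℂ :=
  tabSum M B lam mu fun k c => (k : ℂ) ^ (-(s c))

/-- `M`-truncated diagonally constant Schur multiple zeta value `ζ^M_{λ/μ}(a)`. -/
noncomputable def zetaT (M B : ℕ) (lam mu : ℕ → ℕ) (a : ℤ → ℂ) : ℂ :=
  zetaTF M B lam mu fun c => a ((c.2 : ℤ) - (c.1 : ℤ))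

open Classical in
/-- `ζ^M_{λ/μ}(a)` with the zero convention for non-skew shapes. -/
noncomputable def zetaZ (M B : ℕ) (lam mu : ℕ → ℤ) (a : ℤ → ℂ) : ℂ :=
  if IsSkewZ B lam mu then
    zetaT M B (fun i => (lam i).toNat) (fun i => (mu i).toNat) a else 0

open Classical in
/-- `ζ^M_{λ'/μ'}(a)` applied to conjugates, with the zero convention. -/
noncomputable def zetaZConj (M B : ℕ) (lam mu : ℕ → ℤ) (a : ℤ → ℂ) : ℂ :=
  if IsSkewZ B lam mu then
    zetaT M (lam 0).toNat (conjF (fun i => (lam i).toNat) B)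
      (conjF (fun i => (mu i).toNat) B) a
  else 0

open Classical in
/-- `M`-truncated multiple zeta-star value `ζ^{⋆,M}(s_0,…,s_{d-1})`. -/
noncomputable def zetaStarT (M d : ℕ) (s : ℕ → ℂ) : ℂ :=
  ∑ f ∈ Finset.univ.filter (fun f : Fin d → Fin M => ∀ i j : Fin d, i ≤ j → f i ≤ f j),
    ∏ i : Fin d, (((f i : ℕ) + 1 : ℕ) : ℂ) ^ (-(s i))

open Classical in
/-- `M`-truncated multiple zeta value `ζ^{M}(s_0,…,s_{d-1})`. -/
noncomputable def zetaMT (M d : ℕ) (s : ℕ → ℂ) : ℂ :=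
  ∑ f ∈ Finset.univ.filter (fun f : Fin d → Fin M => ∀ i j : Fin d, i < j → f i < f j),
    ∏ i : Fin d, (((f i : ℕ) + 1 : ℕ) : ℂ) ^ (-(s i))

/-- The Riemann zeta value `ζ(k) = Σ_{n ≥ 1} n^{-k}`. -/
noncomputable def zetaVal (k : ℕ) : ℂ := ∑' n : ℕ, ((n + 1 : ℕ) : ℂ) ^ (-(k : ℤ))

/-- `ζ^⋆(1,k) = Σ_{1 ≤ m ≤ n} m^{-1} n^{-k}`. -/
noncomputable def zetaStarOne (k : ℕ) : ℂ :=
  ∑' n : ℕ, (∑ m ∈ Finset.Icc 1 (n + 1), ((m : ℂ))⁻¹) * ((n + 1 : ℕ) : ℂ) ^ (-(k : ℤ))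


section LinAlg

variable {R : Type*} [CommRing R] {ι : Type*} [Fintype ι] [DecidableEq ι]

lemma pq_block_det (A B E : Matrix ι ι R) (hE : E * E = E) :
    (fromBlocks A ((1 - E) * A) (E * B) B).det =
      ((1 - E) * A + E * B).det * (E * A + (1 - E) * B).det := by
  have h1 : fromBlocks 1 E 0 1 * (fromBlocks 1 0 (-E) 1 * (fromBlocks 1 E 0 1 *
      (fromBlocks A ((1 - E) * A) (E * B) B * fromBlocks 1 (-1) 0 1))) =
      fromBlocks ((1 - E) * A + E * B) 0 (-(E * A)) (E * A + (1 - E) * B) := by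
    have hEA : ∀ X : Matrix ι ι R, E * (E * X) = E * X := fun X => by
      rw [← Matrix.mul_assoc, hE]
    simp only [fromBlocks_multiply]
    congr 1 <;>
    · simp only [Matrix.mul_add, Matrix.sub_mul, Matrix.mul_sub, Matrix.one_mul,
        Matrix.mul_one, Matrix.mul_neg, Matrix.neg_mul, hEA, Matrix.zero_mul, Matrix.mul_zero]
      abel
  have h2 := congrArg Matrix.det h1
  simpa [Matrix.det_mul, det_fromBlocks_zero₂₁, det_fromBlocks_zero₁₂] using h2

/-- put a vector in the first half -/
def pqTop (v : ι → R) : ι ⊕ ι → R := Sum.elim v 0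
/-- put a vector in the second half -/
def pqBot (v : ι → R) : ι ⊕ ι → R := Sum.elim 0 v

def pqStay (a b : ι → ι → R) : ι ⊕ ι → (ι ⊕ ι → R) :=
  Sum.elim (fun j => pqTop (a j)) (fun j => pqBot (b j))
def pqMove (a b : ι → ι → R) : ι ⊕ ι → (ι ⊕ ι → R) :=
  Sum.elim (fun j => pqBot (a j)) (fun j => pqTop (b j))

lemma pq_stay_det (a b : ι → ι → R) :
    (of (pqStay a b)).det = (of a).det * (of b).det := by
  rw [← det_fromBlocks_zero₂₁ (of a) 0 (of b)]
  refine congrArg Matrix.det ?_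
  ext i j
  rcases i with i | i <;> rcases j with j | j <;> rfl

def pqSet (K : ι → Prop) [DecidablePred K] : Finset (ι ⊕ ι) :=
  (univ.filter K).disjSum (univ.filter fun j => ¬ K j)

lemma pq_expand (a b : ι → ι → R) (K : ι → Prop) [DecidablePred K] :
    ∑ s ∈ (pqSet K).powerset, (of (s.piecewise (pqMove a b) (pqStay a b))).det =
      (of fun j => if K j then a j else b j).det * (of fun j => if K j then b j else a j).det := by
  have h := (detRowAlternating (R := R) (n := ι ⊕ ι)).toMultilinearMap.map_piecewise_add
    (pqMove a b) (pqStay a b) (pqSet K)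
  refine Eq.trans h.symm ?_
  let E : Matrix ι ι R := Matrix.diagonal fun j => if K j then 0 else 1
  have hE : E * E = E := by
    simp only [E, Matrix.diagonal_mul_diagonal]
    congr 1; ext j; split_ifs <;> simp
  have h1E : 1 - E = Matrix.diagonal fun j => if K j then 1 else 0 := by
    ext i j
    simp only [E, Matrix.sub_apply, Matrix.one_apply, Matrix.diagonal_apply]
    split_ifs <;> simp
  have hb := pq_block_det (of a) (of b) E hE
  have e1 : ((1 - E) * of a + E * of b) = of fun j => if K j then a j else b j := by
    rw [h1E]; ext i j
    simp only [E, Matrix.add_apply, Matrix.diagonal_mul, of_apply]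
    split_ifs <;> simp
  have e2 : (E * of a + (1 - E) * of b) = of fun j => if K j then b j else a j := by
    rw [h1E]; ext i j
    simp only [E, Matrix.add_apply, Matrix.diagonal_mul, of_apply]
    split_ifs <;> simp
  rw [e1, e2] at hb
  rw [← hb]
  change (of ((pqSet K).piecewise (pqMove a b + pqStay a b) (pqStay a b))).det = _
  congr 1
  rw [h1E]
  ext i j
  rcases i with i | i <;> rcases j with j | j <;>
    by_cases hK : K i <;>
    simp [Finset.piecewise, pqSet, pqMove, pqStay, pqTop, pqBot, E, Matrix.diagonal_mul, hK]

lemma pq_zero_common (a b : ι → ι → R) (s : Finset (ι ⊕ ι)) (j : ι) (hj : a j = b j)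
    (h : (Sum.inl j ∈ s ∧ Sum.inr j ∉ s) ∨ (Sum.inl j ∉ s ∧ Sum.inr j ∈ s)) :
    (of (s.piecewise (pqMove a b) (pqStay a b))).det = 0 := by
  apply det_zero_of_row_eq (i := Sum.inl j) (j := Sum.inr j) (by simp)
  ext x
  rcases h with h | h <;> simp [Finset.piecewise, h, pqMove, pqStay, hj]

lemma pq_zero_of_many (c : ι ⊕ ι → (ι ⊕ ι → R)) (s : Finset (ι ⊕ ι)) (t : Finset (ι ⊕ ι))
    (hst : t.card < s.card) (h : ∀ x ∈ s, ∀ y, y ∉ t → c x y = 0) : (of c).det = 0 := by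
  rw [← det_transpose, det_apply]
  apply Finset.sum_eq_zero
  intro σ _
  have : ∃ x ∈ s, σ x ∉ t := by
    by_contra! hc
    have := Finset.card_le_card_of_injOn σ hc σ.injective.injOn
    omega
  obtain ⟨x, hx, hy⟩ := this
  have : ∏ i, (of c)ᵀ (σ i) i = 0 := Finset.prod_eq_zero (Finset.mem_univ x) (by simp [h x hx _ hy])
  rw [this, smul_zero]

lemma pq_zero_card (a b : ι → ι → R) (P Q : Finset ι) (hPQ : P.card ≠ Q.card) :
    (of ((P.disjSum Q).piecewise (pqMove a b) (pqStay a b))).det = 0 := by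
  have hP : (univ \ P : Finset ι).card + P.card = Fintype.card ι := by
    rw [Finset.card_sdiff_add_card_eq_card (Finset.subset_univ P)]; rfl
  have hQ : (univ \ Q : Finset ι).card + Q.card = Fintype.card ι := by
    rw [Finset.card_sdiff_add_card_eq_card (Finset.subset_univ Q)]; rfl
  rcases lt_or_gt_of_ne hPQ with h | h
  · apply pq_zero_of_many _ ((univ \ P).disjSum Q) ((univ : Finset ι).disjSum ∅)
    · simp only [Finset.card_disjSum, Finset.card_univ, Finset.card_empty]; omega
    · rintro (x | x) hx (y | y) hy <;>
        simp_all [Finset.piecewise, pqMove, pqStay, pqTop, pqBot]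
  · apply pq_zero_of_many _ (P.disjSum (univ \ Q)) ((∅ : Finset ι).disjSum univ)
    · simp only [Finset.card_disjSum, Finset.card_univ, Finset.card_empty]; omega
    · rintro (x | x) hx (y | y) hy <;>
        simp_all [Finset.piecewise, pqMove, pqStay, pqTop, pqBot]

end LinAlg

/-- iterated update -/
def pqUpd {ι V : Type*} [DecidableEq ι] (f : ι → V) : ℕ → (ℕ → ι) → (ℕ → V) → ι → V
  | 0, _, _ => f
  | t + 1, p, v => Function.update (pqUpd f t (fun i => p (i + 1)) (fun i => v (i + 1))) (p 0) (v 0)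

lemma pqUpd_comp {ι V W : Type*} [DecidableEq ι] (φ : V → W) (f : ι → V) (t : ℕ) (p : ℕ → ι)
    (v : ℕ → V) (j : ι) :
    φ (pqUpd f t p v j) = pqUpd (fun j => φ (f j)) t p (fun i => φ (v i)) j := by
  induction t generalizing p v with
  | zero => rfl
  | succ t ih =>
    simp only [pqUpd, Function.update_apply]
    split_ifs
    · rfl
    · exact ih _ _

def pqS {ι : Type*} [DecidableEq ι] (t : ℕ) (p q : ℕ → ι) : Finset (ι ⊕ ι) :=
  ((range t).image p).disjSum ((range t).image q)

lemma pqS_succ {ι : Type*} [DecidableEq ι] (t : ℕ) (p q : ℕ → ι) : pqS (t + 1) p q =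
    insert (Sum.inl (p 0)) (insert (Sum.inr (q 0))
      (pqS t (fun i => p (i + 1)) (fun i => q (i + 1)))) := by
  have key : ∀ (p : ℕ → ι) (x : ι),
      (∃ i ≤ t, p i = x) ↔ (x = p 0 ∨ ∃ i < t, p (i + 1) = x) := by
    intro p x
    constructor
    · rintro ⟨_ | i, hi, rfl⟩
      · exact Or.inl rfl
      · exact Or.inr ⟨i, by omega, rfl⟩
    · rintro (rfl | ⟨i, hi, rfl⟩)
      · exact ⟨0, by omega, rfl⟩
      · exact ⟨i + 1, by omega, rfl⟩
  ext x
  rcases x with x | x <;> simp [pqS, key]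

section LinAlg2
variable {R : Type*} [CommRing R] {ι : Type*} [Fintype ι] [DecidableEq ι]

lemma pq_swap_perm (a b : ι → ι → R) (t : ℕ) (p q : ℕ → ι)
    (hp : ∀ i j, i < j → j < t → p i ≠ p j) (hq : ∀ i j, i < j → j < t → q i ≠ q j) :
    ∃ σ : Equiv.Perm (ι ⊕ ι), Equiv.Perm.sign σ = (-1) ^ t ∧
      (∀ x, x ∉ pqS t p q → σ x = x) ∧
      ∀ x, pqStay (pqUpd a t p (fun i => b (q i))) (pqUpd b t q (fun i => a (p i))) x =
        (pqS t p q).piecewise (pqMove a b) (pqStay a b) (σ x) := by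
  induction t generalizing p q with
  | zero => exact ⟨1, by simp, by simp, fun x => by simp [pqS, pqUpd, Finset.piecewise]⟩
  | succ t ih =>
    obtain ⟨σ, h1, h2, h3⟩ := ih (fun i => p (i + 1)) (fun i => q (i + 1))
      (fun i j h h' => hp _ _ (by omega) (by omega)) (fun i j h h' => hq _ _ (by omega) (by omega))
    set s := pqS t (fun i => p (i + 1)) (fun i => q (i + 1)) with hs
    have hpn : Sum.inl (p 0) ∉ s := by
      simp only [hs, pqS, Finset.inl_mem_disjSum, Finset.mem_image, Finset.mem_range, not_exists,
        not_and]
      intro i hi h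
      exact hp 0 (i + 1) (by omega) (by omega) h.symm
    have hqn : Sum.inr (q 0) ∉ s := by
      simp only [hs, pqS, Finset.inr_mem_disjSum, Finset.mem_image, Finset.mem_range, not_exists,
        not_and]
      intro i hi h
      exact hq 0 (i + 1) (by omega) (by omega) h.symm
    have hσp := h2 _ hpn
    have hσq := h2 _ hqn
    refine ⟨σ * Equiv.swap (Sum.inl (p 0)) (Sum.inr (q 0)), ?_, ?_, ?_⟩
    · rw [Equiv.Perm.sign_mul, h1, Equiv.Perm.sign_swap (by simp), pow_succ]
    · intro x hx
      rw [pqS_succ, ← hs] at hx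
      simp only [Finset.mem_insert, not_or] at hx
      rw [Equiv.Perm.mul_apply, Equiv.swap_apply_of_ne_of_ne hx.1 hx.2.1, h2 x hx.2.2]
    · intro x
      rw [pqS_succ, ← hs, Equiv.Perm.mul_apply]
      by_cases hx1 : x = Sum.inl (p 0)
      · subst hx1
        rw [Equiv.swap_apply_left, hσq]
        simp [Finset.piecewise, pqUpd, pqStay, pqMove]
      · by_cases hx2 : x = Sum.inr (q 0)
        · subst hx2
          rw [Equiv.swap_apply_right, hσp]
          simp [Finset.piecewise, pqUpd, pqStay, pqMove]
        · rw [Equiv.swap_apply_of_ne_of_ne hx1 hx2]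
          have e1 : σ x ≠ Sum.inl (p 0) := fun h => hx1 (σ.injective (h.trans hσp.symm))
          have e2 : σ x ≠ Sum.inr (q 0) := fun h => hx2 (σ.injective (h.trans hσq.symm))
          have e3 : (insert (Sum.inl (p 0)) (insert (Sum.inr (q 0)) s)).piecewise
              (pqMove a b) (pqStay a b) (σ x) = s.piecewise (pqMove a b) (pqStay a b) (σ x) := by
            simp [Finset.piecewise, e1, e2]
          rw [e3, ← h3 x]
          rcases x with x | x
          · have : x ≠ p 0 := fun h => hx1 (by rw [h])
            simp [pqStay, pqUpd, this]
          · have : x ≠ q 0 := fun h => hx2 (by rw [h])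
            simp [pqStay, pqUpd, this]

lemma pq_term_det (a b : ι → ι → R) (t : ℕ) (p q : ℕ → ι)
    (hp : ∀ i j, i < j → j < t → p i ≠ p j) (hq : ∀ i j, i < j → j < t → q i ≠ q j) :
    (of ((pqS t p q).piecewise (pqMove a b) (pqStay a b))).det =
      (-1) ^ t * ((of (pqUpd a t p (fun i => b (q i)))).det *
        (of (pqUpd b t q (fun i => a (p i)))).det) := by
  obtain ⟨σ, h1, -, h3⟩ := pq_swap_perm a b t p q hp hq
  rw [← pq_stay_det]
  have : of (pqStay (pqUpd a t p (fun i => b (q i))) (pqUpd b t q (fun i => a (p i)))) =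
      (of ((pqS t p q).piecewise (pqMove a b) (pqStay a b))).submatrix σ id := by
    ext x y
    simp [h3]
  rw [this, det_permute, h1, ← mul_assoc]
  have : ((-1 : R)) ^ t * (((-1 : ℤˣ) ^ t : ℤˣ) : ℤ) = 1 := by
    push_cast
    rw [← mul_pow]; simp
  rw [this, one_mul]

end LinAlg2

section Comb

lemma pq_conj_lt {κ : ℕ → ℕ} {B : ℕ} (hκ : Antitone κ) (h0 : ∀ i, B ≤ i → κ i = 0) (c k : ℕ) :
    c < conjF κ B k ↔ k < κ c := by
  unfold conjF
  constructor
  · intro h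
    by_contra hc
    have : ((Finset.range B).filter fun j => k + 1 ≤ κ j) ⊆ Finset.range c := by
      intro j hj
      simp only [Finset.mem_filter, Finset.mem_range] at hj ⊢
      by_contra hjc
      have := hκ (not_lt.1 hjc)
      omega
    have := Finset.card_le_card this
    rw [Finset.card_range] at this
    omega
  · intro h
    have : Finset.range (c + 1) ⊆ ((Finset.range B).filter fun j => k + 1 ≤ κ j) := by
      intro j hj
      simp only [Finset.mem_filter, Finset.mem_range] at hj ⊢
      have h1 := hκ (show j ≤ c by omega)
      refine ⟨?_, by omega⟩
      by_contra hB
      have := h0 j (by omega)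
      omega
    have := Finset.card_le_card this
    rw [Finset.card_range] at this
    omega

lemma pq_eq_of_lt {x y : ℕ} (h : ∀ c, c < x ↔ c < y) : x = y := by
  have h1 := h x
  have h2 := h y
  omega

lemma pq_antitone_add {κ : ℕ → ℕ} (hκ : Antitone κ) {a b : ℕ} (ha : 1 ≤ a) (hab : a ≤ b)
    (hc : κ a < κ (a - 1)) : Antitone (AddOp a b κ) := by
  apply antitone_nat_of_succ_le
  intro i
  have h1 := hκ (show i ≤ i + 1 by omega)
  have h2 := hκ (show i - 1 ≤ i by omega)
  have h3 : a ≤ i → κ i ≤ κ a := fun h => hκ h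
  have h4 : i ≤ a - 1 → κ (a - 1) ≤ κ i := fun h => hκ h
  simp only [AddOp, Nat.add_sub_cancel]
  split_ifs <;> omega

lemma pq_antitone_rem {κ : ℕ → ℕ} (hκ : Antitone κ) {a b : ℕ} (ha : 1 ≤ a) (hab : a ≤ b)
    (hc : κ b < κ (b - 1)) : Antitone (RemOp a b κ) := by
  apply antitone_nat_of_succ_le
  intro i
  have h1 := hκ (show i ≤ i + 1 by omega)
  have h2 := hκ (show i + 1 ≤ i + 1 + 1 by omega)
  simp only [RemOp]
  by_cases e1 : i + 1 + 1 < a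
  · rw [if_pos e1, if_pos (by omega)]; exact h1
  rw [if_neg e1]
  by_cases e2 : i + 1 + 1 ≤ b - 1
  · rw [if_pos e2]; split_ifs <;> omega
  rw [if_neg e2]
  by_cases e3 : i + 1 + 1 = b
  · subst e3
    simp only [add_tsub_cancel_right] at hc ⊢
    split_ifs <;> omega
  rw [if_neg e3]
  rw [if_neg (by omega), if_neg (by omega)]
  by_cases e4 : i + 1 = b
  · subst e4; rw [if_pos rfl]
  · rw [if_neg e4]; exact h1

/-- effect of `AddOp` on the conjugate -/
lemma pq_conj_add {κ : ℕ → ℕ} {B : ℕ} (hκ : Antitone κ) (h0 : ∀ i, B ≤ i → κ i = 0)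
    {a b : ℕ} (ha : 1 ≤ a) (hab : a ≤ b) (hc : κ a < κ (a - 1)) (hb : b < B) (k : ℕ) :
    conjF (AddOp a b κ) B k =
      if κ b < k ∧ k < κ (a - 1) then conjF κ B (k - 1) + 1
      else if k = κ b then b + 1 else conjF κ B k := by
  have h0' : ∀ i, B ≤ i → AddOp a b κ i = 0 := by
    intro i hi
    simp only [AddOp]
    rw [if_neg (by omega), if_neg (by omega), if_neg (by omega)]
    exact h0 i hi
  have hA := pq_conj_lt (pq_antitone_add hκ ha hab hc) h0'
  have hL := pq_conj_lt hκ h0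
  have hba := hκ hab
  apply pq_eq_of_lt
  intro c
  rw [hA]
  split_ifs with h1 h2
  · have e : c < conjF κ B (k - 1) + 1 ↔ c = 0 ∨ k - 1 < κ (c - 1) := by
      rcases c with _ | c
      · simp
      · have := hL c (k - 1)
        simp only [add_tsub_cancel_right]
        omega
    rw [e]
    simp only [AddOp]
    split_ifs with g1 g2 g3
    · have := hκ (show c ≤ a - 1 by omega)
      have := hκ (show c - 1 ≤ a - 1 by omega)
      omega
    · have : c - 1 = a - 1 := by omega
      rw [this]; omega
    · omega
    · have := hκ (show b ≤ c by omega)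
      have := hκ (show b ≤ c - 1 by omega)
      omega
  · subst h2
    simp only [AddOp]
    split_ifs with g1 g2 g3
    · have := hκ (show c ≤ a - 1 by omega)
      omega
    · omega
    · have := hκ (show c - 1 ≤ b by omega)
      omega
    · have := hκ (show b ≤ c by omega)
      omega
  · rw [hL]
    simp only [AddOp]
    split_ifs with g1 g2 g3
    · rfl
    · have := hκ (show c ≤ b by omega)
      have := hκ (show b ≤ b + 1 by omega)
      have := hκ (show a ≤ c by omega)
      have := hκ (show b ≤ b by omega)
      have := hκ (show a - 1 ≤ a by omega)
      omega
    · have := hκ (show c ≤ b by omega)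
      have := hκ (show c - 1 ≤ b by omega)
      have := hκ (show a ≤ c - 1 by omega)
      have := hκ (show a - 1 ≤ c by omega)
      omega
    · rfl

/-- effect of `RemOp` on the conjugate -/
lemma pq_conj_rem {κ : ℕ → ℕ} {B : ℕ} (hκ : Antitone κ) (h0 : ∀ i, B ≤ i → κ i = 0)
    {a b : ℕ} (ha : 1 ≤ a) (hab : a ≤ b) (hc : κ b < κ (b - 1)) (hb : b < B) (k : ℕ) :
    conjF (RemOp a b κ) B k =
      if κ b ≤ k ∧ k + 1 < κ (a - 1) then conjF κ B (k + 1) - 1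
      else if k + 1 = κ (a - 1) then a - 1 else conjF κ B k := by
  have h0' : ∀ i, B ≤ i → RemOp a b κ i = 0 := by
    intro i hi
    simp only [RemOp]
    rw [if_neg (by omega), if_neg (by omega), if_neg (by omega)]
    exact h0 i hi
  have hA := pq_conj_lt (pq_antitone_rem hκ ha hab hc) h0'
  have hL := pq_conj_lt hκ h0
  have hba := hκ (show a - 1 ≤ b - 1 by omega)
  apply pq_eq_of_lt
  intro c
  rw [hA]
  split_ifs with h1 h2
  · have e : c < conjF κ B (k + 1) - 1 ↔ k + 1 < κ (c + 1) := by
      have := hL (c + 1) (k + 1)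
      omega
    rw [e]
    simp only [RemOp]
    split_ifs with g1 g2 g3
    · have := hκ (show c ≤ a - 1 by omega)
      have := hκ (show c + 1 ≤ a - 1 by omega)
      omega
    · omega
    · rw [g3]; omega
    · have := hκ (show b ≤ c by omega)
      have := hκ (show b ≤ c + 1 by omega)
      omega
  · simp only [RemOp]
    split_ifs with g1 g2 g3
    · have := hκ (show c ≤ a - 1 by omega)
      omega
    · have := hκ (show a - 1 ≤ c + 1 by omega)
      omega
    · omega
    · have := hκ (show b ≤ c by omega)
      omega
  · rw [hL]
    simp only [RemOp]
    split_ifs with g1 g2 g3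
    · rfl
    · have := hκ (show c + 1 ≤ b - 1 by omega)
      have := hκ (show c ≤ b - 1 by omega)
      have := hκ (show a - 1 ≤ c + 1 by omega)
      have := hκ (show a - 1 ≤ c by omega)
      omega
    · have e : c = b - 1 := by omega
      rw [e]
      omega
    · rfl

end Comb

section pqCols
variable {R : Type*} [CommRing R] {N : ℕ}

/-- Columns of `U` cut to `r + 1` rows (plus the last unit vector at `none`). -/
def pqCol (U : Matrix (Fin N) (Fin N) R) (r : ℕ) : Option ℕ → Fin (r + 1) → R
  | none => fun i => if i = Fin.last r then 1 else 0
  | some x => fun i => matExt U (i : ℕ) x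

def pqA (lam : ℕ → ℕ) (r : ℕ) : Fin (r + 1) → Option ℕ :=
  fun j => if (j : ℕ) < r then some (lam (r - 1 - (j : ℕ)) + (j : ℕ)) else none

def pqB (lam : ℕ → ℕ) (r : ℕ) : Fin (r + 1) → Option ℕ :=
  fun j => some (lam (r - (j : ℕ)) + (j : ℕ))

def pqD (U : Matrix (Fin N) (Fin N) R) (r : ℕ) (f : Fin (r + 1) → Option ℕ) : R :=
  (of fun j => pqCol U r (f j)).det

lemma pqD_comp (U : Matrix (Fin N) (Fin N) R) (r : ℕ) (f : Fin (r + 1) → Option ℕ)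
    (σ : Equiv.Perm (Fin (r + 1))) :
    pqD U r (f ∘ σ) = ((Equiv.Perm.sign σ : ℤ) : R) * pqD U r f := by
  unfold pqD
  rw [← Matrix.det_permute]
  rfl

lemma pq_schur_a (U : Matrix (Fin N) (Fin N) R) (r : ℕ) (lam : ℕ → ℕ) :
    SchurV U r lam (fun _ => 0) = pqD U r (pqA lam r) := by
  unfold pqD SchurV
  rw [Matrix.det_succ_row _ (Fin.last r), Finset.sum_eq_single (Fin.last r)]
  · rw [← Matrix.det_transpose]
    simp only [Fin.val_last, ← two_mul, pow_mul, of_apply]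
    simp only [even_two, Even.neg_pow, one_pow, one_mul, pqA, lt_irrefl, if_false, Fin.val_last,
      pqCol, if_true]
    congr 1
    ext i j
    simp [maya, pqCol, pqA]
  · intro j _ hj
    simp [pqA, pqCol, hj]
  · simp

lemma pq_schur_b (U : Matrix (Fin N) (Fin N) R) (r : ℕ) (lam : ℕ → ℕ) :
    SchurV U (r + 1) lam (fun _ => 0) = pqD U r (pqB lam r) := by
  unfold pqD SchurV
  rw [← Matrix.det_transpose]
  congr 1
  ext i j
  simp [maya, pqCol, pqB]

end pqCols

lemma pqA_add {κ : ℕ → ℕ} {B : ℕ} (hκ : Antitone κ) (h0 : ∀ i, B ≤ i → κ i = 0)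
    {a b r : ℕ} (ha : 1 ≤ a) (hab : a ≤ b) (hc : κ a < κ (a - 1)) (hb : b < B)
    (hr : κ 0 < r) (p q : Fin (r + 1)) (hp : (p : ℕ) = r - κ (a - 1))
    (hq : (q : ℕ) + 1 = r - κ b) :
    pqA (conjF (AddOp a b κ) B) r =
      Function.update (pqA (conjF κ B) r) p (some (b + (r - κ b))) ∘ Fin.cycleIcc p q := by
  have h1 : κ b ≤ κ a := hκ hab
  have h2 : κ (a - 1) ≤ κ 0 := hκ (Nat.zero_le _)
  have hpq : p ≤ q := by rw [Fin.le_def]; omega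
  funext j
  have hj := j.2
  simp only [Function.comp]
  rcases lt_or_ge j p with hjp | hjp
  · rw [Fin.cycleIcc_of_lt hjp, Function.update_of_ne (ne_of_lt hjp)]
    rw [Fin.lt_def] at hjp
    unfold pqA
    rw [pq_conj_add hκ h0 ha hab hc hb]
    have e1 : ¬ (κ b < r - 1 - (j : ℕ) ∧ r - 1 - (j : ℕ) < κ (a - 1)) := by omega
    have e2 : ¬ (r - 1 - (j : ℕ) = κ b) := by omega
    rw [if_neg e1, if_neg e2]
  rcases lt_trichotomy j q with hjq | hjq | hjq
  · rw [Fin.cycleIcc_of_ge_of_lt hjp hjq]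
    rw [Fin.lt_def] at hjq
    rw [Fin.le_def] at hjp
    have hv : ((j + 1 : Fin (r + 1)) : ℕ) = j + 1 := by
      apply Fin.val_add_one_of_lt
      rw [Fin.lt_def]; have := q.2; simp; omega
    rw [Function.update_of_ne]
    · unfold pqA
      rw [hv, pq_conj_add hκ h0 ha hab hc hb]
      have e1 : (κ b < r - 1 - (j : ℕ) ∧ r - 1 - (j : ℕ) < κ (a - 1)) := by omega
      rw [if_pos e1, if_pos (by omega), if_pos (by omega)]
      rw [show r - 1 - (j : ℕ) - 1 = r - 1 - (j + 1) by omega]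
      congr 1
      omega
    · intro h
      have := congrArg Fin.val h
      omega
  · subst hjq
    rw [Fin.cycleIcc_of_last hpq, Function.update_self]
    unfold pqA
    rw [pq_conj_add hκ h0 ha hab hc hb]
    have e1 : ¬ (κ b < r - 1 - (j : ℕ) ∧ r - 1 - (j : ℕ) < κ (a - 1)) := by omega
    have e2 : (r - 1 - (j : ℕ) = κ b) := by omega
    rw [if_neg e1, if_pos e2, if_pos (by omega)]
    congr 1
    omega
  · rw [Fin.cycleIcc_of_gt hjq, Function.update_of_ne (ne_of_gt (lt_of_le_of_lt hpq hjq))]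
    rw [Fin.lt_def] at hjq
    unfold pqA
    by_cases hjr : (j : ℕ) < r
    · rw [pq_conj_add hκ h0 ha hab hc hb]
      have e1 : ¬ (κ b < r - 1 - (j : ℕ) ∧ r - 1 - (j : ℕ) < κ (a - 1)) := by omega
      have e2 : ¬ (r - 1 - (j : ℕ) = κ b) := by omega
      rw [if_neg e1, if_neg e2]
    · rw [if_neg hjr, if_neg hjr]

lemma pqB_rem {κ : ℕ → ℕ} {B : ℕ} (hκ : Antitone κ) (h0 : ∀ i, B ≤ i → κ i = 0)
    {a b r : ℕ} (ha : 1 ≤ a) (hab : a ≤ b) (hc : κ b < κ (b - 1)) (hb : b < B)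
    (hr : κ 0 < r) (p q : Fin (r + 1)) (hp : (p : ℕ) = r - κ (a - 1) + 1)
    (hq : (q : ℕ) = r - κ b) :
    pqB (conjF (RemOp a b κ) B) r =
      Function.update (pqB (conjF κ B) r) q (some (a + (r - κ (a - 1)))) ∘
        ((Fin.cycleIcc p q)⁻¹ : Equiv.Perm (Fin (r + 1))) := by
  have h1 : κ (b - 1) ≤ κ (a - 1) := hκ (by omega)
  have h2 : κ (a - 1) ≤ κ 0 := hκ (Nat.zero_le _)
  have hpq : p ≤ q := by rw [Fin.le_def]; omega
  suffices h : pqB (conjF (RemOp a b κ) B) r ∘ Fin.cycleIcc p q =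
      Function.update (pqB (conjF κ B) r) q (some (a + (r - κ (a - 1)))) by
    rw [← h, Function.comp_assoc]
    funext j
    simp
  funext j
  have hj := j.2
  simp only [Function.comp]
  rcases lt_or_ge j p with hjp | hjp
  · rw [Fin.cycleIcc_of_lt hjp, Function.update_of_ne (ne_of_lt (lt_of_lt_of_le hjp hpq))]
    rw [Fin.lt_def] at hjp
    unfold pqB
    rw [pq_conj_rem hκ h0 ha hab hc hb]
    have e1 : ¬ (κ b ≤ r - (j : ℕ) ∧ r - (j : ℕ) + 1 < κ (a - 1)) := by omega
    have e2 : ¬ (r - (j : ℕ) + 1 = κ (a - 1)) := by omega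
    rw [if_neg e1, if_neg e2]
  rcases lt_trichotomy j q with hjq | hjq | hjq
  · rw [Fin.cycleIcc_of_ge_of_lt hjp hjq, Function.update_of_ne (ne_of_lt hjq)]
    rw [Fin.lt_def] at hjq
    rw [Fin.le_def] at hjp
    have hv : ((j + 1 : Fin (r + 1)) : ℕ) = j + 1 := by
      apply Fin.val_add_one_of_lt
      rw [Fin.lt_def]; have := q.2; simp; omega
    unfold pqB
    rw [hv, pq_conj_rem hκ h0 ha hab hc hb]
    have e1 : (κ b ≤ r - (j + 1 : ℕ) ∧ r - (j + 1 : ℕ) + 1 < κ (a - 1)) := by omega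
    rw [if_pos e1]
    rw [show r - ((j : ℕ) + 1) + 1 = r - j by omega]
    have : 0 < conjF κ B (r - j) := by
      rw [pq_conj_lt hκ h0]; omega
    congr 1
    omega
  · subst hjq
    rw [Fin.cycleIcc_of_last hpq, Function.update_self]
    unfold pqB
    rw [pq_conj_rem hκ h0 ha hab hc hb]
    have e1 : ¬ (κ b ≤ r - (p : ℕ) ∧ r - (p : ℕ) + 1 < κ (a - 1)) := by omega
    have e2 : (r - (p : ℕ) + 1 = κ (a - 1)) := by rw [Fin.le_def] at hpq; omega
    rw [if_neg e1, if_pos e2]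
    congr 1
    omega
  · rw [Fin.cycleIcc_of_gt hjq, Function.update_of_ne (ne_of_gt hjq)]
    rw [Fin.lt_def] at hjq
    unfold pqB
    rw [pq_conj_rem hκ h0 ha hab hc hb]
    have e1 : ¬ (κ b ≤ r - (j : ℕ) ∧ r - (j : ℕ) + 1 < κ (a - 1)) := by omega
    have e2 : ¬ (r - (j : ℕ) + 1 = κ (a - 1)) := by omega
    rw [if_neg e1, if_neg e2]


lemma pq_update_comp {ι V : Type*} [DecidableEq ι] (f : ι → V) (π : Equiv.Perm ι) (x : ι)
    (hx : π x = x) (v : V) : Function.update (f ∘ π) x v = Function.update f x v ∘ π := by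
  funext j
  by_cases h : j = x
  · subst h
    simp [hx]
  · have : π j ≠ x := fun h' => h (π.injective (h'.trans hx.symm))
    simp [Function.update_of_ne h, Function.update_of_ne this]

lemma iterOp_succ (op : ℕ → ℕ → (ℕ → ℕ) → ℕ → ℕ) (t : ℕ) (a b : ℕ → ℕ) (k : ℕ → ℕ) :
    iterOp op (t + 1) a b k =
      op (a 0) (b 0) (iterOp op t (fun i => a (i + 1)) (fun i => b (i + 1)) k) := by
  unfold iterOp
  rw [List.range_succ_eq_map]
  simp [List.foldr_map]

lemma pq_conj_bot {κ : ℕ → ℕ} {B : ℕ} (hκ : Antitone κ) (h0 : ∀ i, B ≤ i → κ i = 0) {b : ℕ}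
    (hb : κ b < κ (b - 1)) : conjF κ B (κ b) = b := by
  apply pq_eq_of_lt
  intro c
  rw [pq_conj_lt hκ h0]
  constructor
  · intro h
    by_contra hc
    have := hκ (show b ≤ c by omega)
    omega
  · intro h
    have := hκ (show c ≤ b - 1 by omega)
    omega

lemma pq_conj_top {κ : ℕ → ℕ} {B : ℕ} (hκ : Antitone κ) (h0 : ∀ i, B ≤ i → κ i = 0) {a : ℕ}
    (ha : 1 ≤ a) (hc : κ a < κ (a - 1)) : conjF κ B (κ (a - 1) - 1) = a := by
  apply pq_eq_of_lt
  intro c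
  rw [pq_conj_lt hκ h0]
  constructor
  · intro h
    by_contra hc
    have := hκ (show a ≤ c by omega)
    omega
  · intro h
    have := hκ (show c ≤ a - 1 by omega)
    omega

lemma pqA_iter {κ : ℕ → ℕ} {B r : ℕ} (hκ : Antitone κ) (h0 : ∀ i, B ≤ i → κ i = 0)
    (hr : κ 0 < r) (t : ℕ) : ∀ (a b : ℕ → ℕ) (P Q : ℕ → Fin (r + 1)),
    (∀ i, i < t → 1 ≤ a i) → (∀ i, i < t → a i ≤ b i) → (∀ i, i < t → κ (a i) < κ (a i - 1)) →
    (∀ i, i < t → κ (b i) < κ (b i - 1)) → (∀ i, i < t → b i < B) →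
    (∀ i j, i < j → j < t → a i < a j) → (∀ i j, i < j → j < t → b j < b i) →
    (∀ i, i < t → (P i : ℕ) = r - κ (a i - 1)) → (∀ i, i < t → (Q i : ℕ) = r - κ (b i)) →
    Antitone (iterOp AddOp t a b κ) ∧ (∀ i, B ≤ i → iterOp AddOp t a b κ i = 0) ∧
    (∀ x, (∀ j, j < t → x < a j ∨ b j < x) → iterOp AddOp t a b κ x = κ x) ∧
    ∃ π : Equiv.Perm (Fin (r + 1)),
      Equiv.Perm.sign π = ∏ i ∈ Finset.range t, (-1) ^ ((Q i : ℕ) - 1 - (P i : ℕ)) ∧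
      (∀ x, (∀ j, j < t → x < P j ∨ Q j ≤ x) → π x = x) ∧
      pqA (conjF (iterOp AddOp t a b κ) B) r =
        pqUpd (pqA (conjF κ B) r) t P (fun i => pqB (conjF κ B) r (Q i)) ∘ π := by
  induction t with
  | zero =>
    intro a b P Q _ _ _ _ _ _ _ _ _
    refine ⟨hκ, h0, fun _ _ => rfl, 1, by simp, fun _ _ => rfl, rfl⟩
  | succ t ih =>
    intro a b P Q ha hab hca hcb hb hai hbi hP hQ
    obtain ⟨g1, g2, g3, π, g4, g5, g6⟩ := ih (fun i => a (i + 1)) (fun i => b (i + 1))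
      (fun i => P (i + 1)) (fun i => Q (i + 1))
      (fun i hi => ha _ (by omega)) (fun i hi => hab _ (by omega)) (fun i hi => hca _ (by omega))
      (fun i hi => hcb _ (by omega)) (fun i hi => hb _ (by omega))
      (fun i j hij hj => hai _ _ (by omega) (by omega))
      (fun i j hij hj => hbi _ _ (by omega) (by omega))
      (fun i hi => hP _ (by omega)) (fun i hi => hQ _ (by omega))
    rw [iterOp_succ]
    set κ' := iterOp AddOp t (fun i => a (i + 1)) (fun i => b (i + 1)) κ with hκ'
    have a0 := ha 0 (by omega)
    have ab0 := hab 0 (by omega)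
    have ca0 := hca 0 (by omega)
    have cb0 := hcb 0 (by omega)
    have b0 := hb 0 (by omega)
    have P0 := hP 0 (by omega)
    have Q0 := hQ 0 (by omega)
    have m1 : κ (a 0 - 1) ≤ κ 0 := hκ (Nat.zero_le _)
    have m2 : κ (b 0) ≤ κ (a 0) := hκ ab0
    have e1 : κ' (a 0) = κ (a 0) := g3 _ fun j hj => Or.inl (hai _ _ (by omega) (by omega))
    have e2 : κ' (a 0 - 1) = κ (a 0 - 1) := g3 _ fun j hj => Or.inl (by
      have := hai 0 (j + 1) (by omega) (by omega); omega)
    have e3 : κ' (b 0) = κ (b 0) := g3 _ fun j hj => Or.inr (hbi _ _ (by omega) (by omega))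
    have e4 : κ' 0 = κ 0 := g3 _ fun j hj => Or.inl (by
      have := hai 0 (j + 1) (by omega) (by omega); omega)
    have hc' : κ' (a 0) < κ' (a 0 - 1) := by omega
    refine ⟨pq_antitone_add g1 a0 ab0 hc', ?_, ?_, ?_⟩
    · intro i hi
      have := g2 i hi
      simp only [AddOp]
      split_ifs <;> first | omega | assumption
    · intro x hx
      have hx0 := hx 0 (by omega)
      have := g3 x fun j hj => hx (j + 1) (by omega)
      rw [← this]
      simp only [AddOp]
      split_ifs <;> first | omega | rfl
    · let q' : Fin (r + 1) := ⟨(Q 0 : ℕ) - 1, by omega⟩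
      have hq' : (q' : ℕ) = (Q 0 : ℕ) - 1 := rfl
      have hpq : P 0 ≤ q' := by rw [Fin.le_def]; omega
      have hstep := pqA_add g1 g2 a0 ab0 hc' b0 (by omega : κ' 0 < r) (P 0) q'
        (by rw [e2, P0]) (by rw [e3]; omega)
      refine ⟨π * Fin.cycleIcc (P 0) q', ?_, ?_, ?_⟩
      · rw [Equiv.Perm.sign_mul, g4, Fin.sign_cycleIcc_of_le hpq, Finset.prod_range_succ']
      · intro x hx
        have h1 : Fin.cycleIcc (P 0) q' x = x := by
          rcases hx 0 (by omega) with h | h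
          · exact Fin.cycleIcc_of_lt h
          · apply Fin.cycleIcc_of_gt
            rw [Fin.lt_def]
            rw [Fin.le_def] at h
            omega
        rw [Equiv.Perm.mul_apply, h1]
        exact g5 x fun j hj => hx (j + 1) (by omega)
      · have hfix : π (P 0) = P 0 := by
          apply g5
          intro j hj
          left
          have h1 := hai 0 (j + 1) (by omega) (by omega)
          have h2 := hκ (show a 0 ≤ a (j + 1) - 1 by omega)
          have h3 := hP (j + 1) (by omega)
          rw [Fin.lt_def]
          omega
        have hv : some (b 0 + (r - κ' (b 0))) = pqB (conjF κ B) r (Q 0) := by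
          unfold pqB
          rw [show r - (Q 0 : ℕ) = κ (b 0) by omega, pq_conj_bot hκ h0 cb0, e3, Q0]
        rw [hstep, g6, hv, pq_update_comp _ _ _ hfix, Function.comp_assoc]
        rfl

lemma pqB_iter {κ : ℕ → ℕ} {B r : ℕ} (hκ : Antitone κ) (h0 : ∀ i, B ≤ i → κ i = 0)
    (hr : κ 0 < r) (t : ℕ) : ∀ (a b : ℕ → ℕ) (P Q : ℕ → Fin (r + 1)),
    (∀ i, i < t → 1 ≤ a i) → (∀ i, i < t → a i ≤ b i) → (∀ i, i < t → κ (a i) < κ (a i - 1)) →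
    (∀ i, i < t → κ (b i) < κ (b i - 1)) → (∀ i, i < t → b i < B) →
    (∀ i j, i < j → j < t → a i < a j) → (∀ i j, i < j → j < t → b j < b i) →
    (∀ i, i < t → (P i : ℕ) = r - κ (a i - 1)) → (∀ i, i < t → (Q i : ℕ) = r - κ (b i)) →
    Antitone (iterOp RemOp t a b κ) ∧ (∀ i, B ≤ i → iterOp RemOp t a b κ i = 0) ∧
    (∀ x, (∀ j, j < t → x + 1 < a j ∨ b j ≤ x) → iterOp RemOp t a b κ x = κ x) ∧
    ∃ π : Equiv.Perm (Fin (r + 1)),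
      Equiv.Perm.sign π = ∏ i ∈ Finset.range t, (-1) ^ ((Q i : ℕ) - 1 - (P i : ℕ)) ∧
      (∀ x, (∀ j, j < t → x ≤ P j ∨ Q j < x) → π x = x) ∧
      pqB (conjF (iterOp RemOp t a b κ) B) r =
        pqUpd (pqB (conjF κ B) r) t Q (fun i => pqA (conjF κ B) r (P i)) ∘ π := by
  induction t with
  | zero =>
    intro a b P Q _ _ _ _ _ _ _ _ _
    refine ⟨hκ, h0, fun _ _ => rfl, 1, by simp, fun _ _ => rfl, rfl⟩
  | succ t ih =>
    intro a b P Q ha hab hca hcb hb hai hbi hP hQ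
    obtain ⟨g1, g2, g3, π, g4, g5, g6⟩ := ih (fun i => a (i + 1)) (fun i => b (i + 1))
      (fun i => P (i + 1)) (fun i => Q (i + 1))
      (fun i hi => ha _ (by omega)) (fun i hi => hab _ (by omega)) (fun i hi => hca _ (by omega))
      (fun i hi => hcb _ (by omega)) (fun i hi => hb _ (by omega))
      (fun i j hij hj => hai _ _ (by omega) (by omega))
      (fun i j hij hj => hbi _ _ (by omega) (by omega))
      (fun i hi => hP _ (by omega)) (fun i hi => hQ _ (by omega))
    rw [iterOp_succ]
    set κ' := iterOp RemOp t (fun i => a (i + 1)) (fun i => b (i + 1)) κ with hκ'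
    have a0 := ha 0 (by omega)
    have ab0 := hab 0 (by omega)
    have ca0 := hca 0 (by omega)
    have cb0 := hcb 0 (by omega)
    have b0 := hb 0 (by omega)
    have P0 := hP 0 (by omega)
    have Q0 := hQ 0 (by omega)
    have m1 : κ (a 0 - 1) ≤ κ 0 := hκ (Nat.zero_le _)
    have m2 : κ (b 0) ≤ κ (a 0) := hκ ab0
    have e2 : κ' (a 0 - 1) = κ (a 0 - 1) := g3 _ fun j hj => Or.inl (by
      have := hai 0 (j + 1) (by omega) (by omega); omega)
    have e3 : κ' (b 0) = κ (b 0) := g3 _ fun j hj => Or.inr (by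
      have := hbi 0 (j + 1) (by omega) (by omega); omega)
    have e5 : κ' (b 0 - 1) = κ (b 0 - 1) := g3 _ fun j hj => Or.inr (by
      have := hbi 0 (j + 1) (by omega) (by omega); omega)
    have e4 : κ' 0 = κ 0 := g3 _ fun j hj => Or.inl (by
      have := hai 0 (j + 1) (by omega) (by omega); omega)
    have hc' : κ' (b 0) < κ' (b 0 - 1) := by omega
    refine ⟨pq_antitone_rem g1 a0 ab0 hc', ?_, ?_, ?_⟩
    · intro i hi
      have := g2 i hi
      simp only [RemOp]
      split_ifs <;> first | omega | assumption
    · intro x hx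
      have hx0 := hx 0 (by omega)
      have := g3 x fun j hj => hx (j + 1) (by omega)
      rw [← this]
      simp only [RemOp]
      split_ifs <;> first | omega | rfl
    · let p' : Fin (r + 1) := ⟨(P 0 : ℕ) + 1, by omega⟩
      have hp' : (p' : ℕ) = (P 0 : ℕ) + 1 := rfl
      have hpq : p' ≤ Q 0 := by rw [Fin.le_def]; omega
      have hstep := pqB_rem g1 g2 a0 ab0 hc' b0 (by omega : κ' 0 < r) p' (Q 0)
        (by rw [e2]; omega) (by rw [e3]; omega)
      refine ⟨π * (Fin.cycleIcc p' (Q 0))⁻¹, ?_, ?_, ?_⟩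
      · rw [Equiv.Perm.sign_mul, g4, Equiv.Perm.sign_inv, Fin.sign_cycleIcc_of_le hpq,
          Finset.prod_range_succ']
        congr 2
        omega
      · intro x hx
        have h1 : (Fin.cycleIcc p' (Q 0))⁻¹ x = x := by
          rw [Equiv.Perm.inv_eq_iff_eq]
          symm
          rcases hx 0 (by omega) with h | h
          · apply Fin.cycleIcc_of_lt
            rw [Fin.lt_def]
            rw [Fin.le_def] at h
            omega
          · exact Fin.cycleIcc_of_gt h
        rw [Equiv.Perm.mul_apply, h1]
        exact g5 x fun j hj => hx (j + 1) (by omega)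
      · have hfix : π (Q 0) = Q 0 := by
          apply g5
          intro j hj
          right
          have h1 := hbi 0 (j + 1) (by omega) (by omega)
          have h2 := hκ (show b (j + 1) ≤ b 0 - 1 by omega)
          have h3 := hQ (j + 1) (by omega)
          rw [Fin.lt_def]
          omega
        have hv : some (a 0 + (r - κ' (a 0 - 1))) = pqA (conjF κ B) r (P 0) := by
          unfold pqA
          rw [if_pos (by omega), show r - 1 - (P 0 : ℕ) = κ (a 0 - 1) - 1 by omega,
            pq_conj_top hκ h0 a0 ca0, e2, P0]
        rw [hstep, g6, hv, pq_update_comp _ _ _ hfix, Function.comp_assoc]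
        rfl

/-- The product of Schur functions for an `add`/`rem` pair equals the term of the expansion. -/
lemma pq_term {R : Type*} [CommRing R] {N : ℕ} (U : Matrix (Fin N) (Fin N) R)
    {κ : ℕ → ℕ} {B r : ℕ} (hκ : Antitone κ) (h0 : ∀ i, B ≤ i → κ i = 0)
    (hr : κ 0 < r) (t : ℕ) (a b : ℕ → ℕ) (P Q : ℕ → Fin (r + 1))
    (ha : ∀ i, i < t → 1 ≤ a i) (hab : ∀ i, i < t → a i ≤ b i)
    (hca : ∀ i, i < t → κ (a i) < κ (a i - 1))
    (hcb : ∀ i, i < t → κ (b i) < κ (b i - 1)) (hb : ∀ i, i < t → b i < B)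
    (hai : ∀ i j, i < j → j < t → a i < a j) (hbi : ∀ i j, i < j → j < t → b j < b i)
    (hP : ∀ i, i < t → (P i : ℕ) = r - κ (a i - 1)) (hQ : ∀ i, i < t → (Q i : ℕ) = r - κ (b i)) :
    (of ((pqS t P Q).piecewise
      (pqMove (fun j => pqCol U r (pqA (conjF κ B) r j)) (fun j => pqCol U r (pqB (conjF κ B) r j)))
      (pqStay (fun j => pqCol U r (pqA (conjF κ B) r j))
        (fun j => pqCol U r (pqB (conjF κ B) r j))))).det =
    (-1) ^ t * (SchurV U r (conjF (iterOp AddOp t a b κ) B) (fun _ => 0) *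
      SchurV U (r + 1) (conjF (iterOp RemOp t a b κ) B) (fun _ => 0)) := by
  obtain ⟨-, -, -, π, g4, -, g6⟩ := pqA_iter hκ h0 hr t a b P Q ha hab hca hcb hb hai hbi hP hQ
  obtain ⟨-, -, -, ρ, k4, -, k6⟩ := pqB_iter hκ h0 hr t a b P Q ha hab hca hcb hb hai hbi hP hQ
  rw [pq_term_det]
  · rw [pq_schur_a, pq_schur_b, g6, k6, pqD_comp, pqD_comp, g4, ← k4]
    have hs : ((Equiv.Perm.sign ρ : ℤ) : R) * ((Equiv.Perm.sign ρ : ℤ) : R) = 1 := by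
      rw [← Int.cast_mul, Int.units_coe_mul_self]; simp
    congr 1
    rw [mul_mul_mul_comm, hs, one_mul]
    unfold pqD
    simp only [pqUpd_comp]
  · intro i j hij hj h
    have h1 := hP i (by omega)
    have h2 := hP j hj
    have h3 := hai i j hij hj
    have h4 := hκ (show a i ≤ a j - 1 by omega)
    have h5 := hca i (by omega)
    have h6 : κ (a i - 1) ≤ κ 0 := hκ (Nat.zero_le _)
    rw [h] at h1
    omega
  · intro i j hij hj h
    have h1 := hQ i (by omega)
    have h2 := hQ j hj
    have h3 := hbi i j hij hj
    have h4 := hκ (show b j ≤ b i - 1 by omega)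
    have h5 := hcb i (by omega)
    have h6 : κ (b i - 1) ≤ κ 0 := hκ (Nat.zero_le _)
    have h7 : κ (b j) ≤ κ 0 := hκ (Nat.zero_le _)
    rw [h] at h1
    omega


lemma pq_strict_rr {n : ℕ} {rr : ℕ → ℕ} (hrr : ∀ j, j + 1 < n → rr j < rr (j + 1)) :
    ∀ j i, i < j → j < n → rr i < rr j := by
  intro j
  induction j with
  | zero => intro i hi; omega
  | succ j ih =>
    intro i hi hj
    have h := hrr j hj
    rcases Nat.lt_succ_iff_lt_or_eq.mp hi with h' | h'
    · have := ih i h' (by omega); omega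
    · subst h'; exact h

lemma pq_strict_m {n : ℕ} {m : ℕ → ℕ} (hm : ∀ j, j + 1 < n → m (j + 1) < m j) :
    ∀ j i, i < j → j < n → m j < m i := by
  intro j
  induction j with
  | zero => intro i hi; omega
  | succ j ih =>
    intro i hi hj
    have h := hm j hj
    rcases Nat.lt_succ_iff_lt_or_eq.mp hi with h' | h'
    · have := ih i h' (by omega); omega
    · subst h'; exact h

lemma pq_step_eq {n : ℕ} {m rr : ℕ → ℕ} {i j : ℕ} (hj : j < n) (hi : i < rr j)
    (hlo : ∀ k, k < j → rr k ≤ i) : stepPart n m rr i = m j := by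
  unfold stepPart
  have hmem : j ∈ (Finset.range n).filter fun j => i < rr j := by simp [hj, hi]
  rw [dif_pos ⟨j, hmem⟩]
  congr 1
  apply le_antisymm
  · exact Finset.min'_le _ _ hmem
  · apply Finset.le_min'
    intro y hy
    by_contra hyj
    have h1 := hlo y (by omega)
    simp at hy
    omega

lemma pq_step_zero {n : ℕ} {m rr : ℕ → ℕ} (hrr : ∀ j, j + 1 < n → rr j < rr (j + 1)) {i : ℕ}
    (hi : rr (n - 1) ≤ i) : stepPart n m rr i = 0 := by
  unfold stepPart
  rw [dif_neg]
  rintro ⟨j, hj⟩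
  simp at hj
  have := pq_strict_rr hrr (n - 1) j
  by_cases h : j = n - 1
  · subst h; omega
  · have := this (by omega) (by omega)
    omega

lemma pq_step_form {n : ℕ} {m rr : ℕ → ℕ} (hn : 1 ≤ n) {i : ℕ} (hi : i < rr (n - 1)) :
    ∃ j, j < n ∧ i < rr j ∧ (∀ k, k < j → rr k ≤ i) ∧ stepPart n m rr i = m j := by
  classical
  have hex : ∃ j, i < rr j := ⟨_, hi⟩
  have h1 := Nat.find_spec hex
  have h2 : ∀ k, k < Nat.find hex → rr k ≤ i := fun k hk => by
    have := Nat.find_min hex hk; omega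
  have h3 : Nat.find hex ≤ n - 1 := Nat.find_min' hex hi
  exact ⟨Nat.find hex, by omega, h1, h2, pq_step_eq (by omega) h1 h2⟩

lemma pq_step_antitone {n : ℕ} {m rr : ℕ → ℕ} (hn : 1 ≤ n)
    (hm : ∀ j, j + 1 < n → m (j + 1) < m j)
    (hrr : ∀ j, j + 1 < n → rr j < rr (j + 1)) : Antitone (stepPart n m rr) := by
  intro i i' hii
  rcases lt_or_ge i' (rr (n - 1)) with h | h
  · obtain ⟨j, h1, h2, h3, h4⟩ := pq_step_form (m := m) hn (lt_of_le_of_lt hii h)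
    obtain ⟨j', k1, k2, k3, k4⟩ := pq_step_form (m := m) hn h
    rw [h4, k4]
    rcases lt_trichotomy j j' with hj | hj | hj
    · exact (pq_strict_m hm j' j hj k1).le
    · rw [hj]
    · have := h3 j' hj; omega
  · rw [pq_step_zero hrr h]; exact Nat.zero_le _

lemma pq_rr_pos {n : ℕ} {rr : ℕ → ℕ} (hrr : ∀ j, j + 1 < n → rr j < rr (j + 1))
    (h0 : 0 < rr 0) {j : ℕ} (hj : j < n) : 0 < rr j := by
  rcases Nat.eq_zero_or_pos j with h | h
  · subst h; exact h0
  · have := pq_strict_rr hrr j 0 h hj; omega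

lemma pq_step_top {n : ℕ} {m rr : ℕ → ℕ} (hrr : ∀ j, j + 1 < n → rr j < rr (j + 1))
    (h0 : 0 < rr 0) {j : ℕ} (hj : j < n) : stepPart n m rr (rr j - 1) = m j := by
  have := pq_rr_pos hrr h0 hj
  apply pq_step_eq hj (by omega)
  intro k hk
  have := pq_strict_rr hrr j k hk hj
  omega

lemma pq_step_bot {n : ℕ} {m rr : ℕ → ℕ} (hrr : ∀ j, j + 1 < n → rr j < rr (j + 1))
    {j : ℕ} (hj : j + 1 < n) : stepPart n m rr (rr j) = m (j + 1) := by
  apply pq_step_eq hj (hrr j hj)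
  intro k hk
  rcases Nat.lt_succ_iff_lt_or_eq.mp hk with h | h
  · exact (pq_strict_rr hrr j k h (by omega)).le
  · rw [h]

lemma pq_m_pos {n : ℕ} {m : ℕ → ℕ} (hm : ∀ j, j + 1 < n → m (j + 1) < m j)
    (hmpos : 0 < m (n - 1)) {j : ℕ} (hj : j < n) : 0 < m j := by
  by_cases h : j = n - 1
  · rw [h]; exact hmpos
  · have := pq_strict_m hm (n - 1) j (by omega) (by omega); omega

lemma pq_step_corner {n : ℕ} {m rr : ℕ → ℕ} (hm : ∀ j, j + 1 < n → m (j + 1) < m j)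
    (hmpos : 0 < m (n - 1)) (hrr : ∀ j, j + 1 < n → rr j < rr (j + 1))
    (h0 : 0 < rr 0) {j : ℕ} (hj : j < n) :
    stepPart n m rr (rr j) < stepPart n m rr (rr j - 1) := by
  rw [pq_step_top hrr h0 hj]
  by_cases h : j + 1 < n
  · rw [pq_step_bot hrr h]; exact hm j h
  · have : j = n - 1 := by omega
    subst this
    rw [pq_step_zero hrr le_rfl]; exact hmpos

section pqMain
variable {κ : ℕ → ℕ} {B r l : ℕ}

lemma pqA_minus (hκ : Antitone κ) (h0 : ∀ i, B ≤ i → κ i = 0) (hc : κ l < κ (l - 1))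
    (hr : κ 0 < r) (j : Fin (r + 1)) :
    pqA (conjF (fun i => if i < l then κ i - 1 else κ i) B) r j =
      if (j : ℕ) < r + 1 - κ (l - 1) then pqB (conjF κ B) r j else pqA (conjF κ B) r j := by
  have hM : κ (l - 1) ≤ κ 0 := hκ (Nat.zero_le _)
  have hj := j.2
  have hlt : ∀ c, c < l → κ (l - 1) ≤ κ c := fun c h => hκ (by omega)
  have hge : ∀ c, l ≤ c → κ c ≤ κ l := fun c h => hκ h
  have hκ' : Antitone (fun i => if i < l then κ i - 1 else κ i) := by
    intro x y hxy
    have h1 := hκ hxy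
    have h2 := hlt x
    have h3 := hge y
    simp only
    split_ifs <;> omega
  have h0' : ∀ i, B ≤ i → (fun i => if i < l then κ i - 1 else κ i) i = 0 := by
    intro i hi
    have := h0 i hi
    simp [this]
  have hkey : ∀ k, conjF (fun i => if i < l then κ i - 1 else κ i) B k =
      if κ (l - 1) ≤ k + 1 then conjF κ B (k + 1) else conjF κ B k := by
    intro k
    apply pq_eq_of_lt
    intro c
    rw [pq_conj_lt hκ' h0']
    have h2 := hlt c
    have h3 := hge c
    split_ifs with h <;> rw [pq_conj_lt hκ h0] <;> omega
  unfold pqA pqB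
  by_cases hjr : (j : ℕ) < r
  · rw [if_pos hjr, if_pos hjr, hkey, show r - 1 - (j : ℕ) + 1 = r - j by omega]
    split_ifs <;> first | rfl | omega
  · rw [if_neg hjr, if_neg hjr, if_neg (by omega)]

lemma pqB_plus (hκ : Antitone κ) (h0 : ∀ i, B ≤ i → κ i = 0) (hc : κ l < κ (l - 1))
    (hlB : l ≤ B) (hr : κ 0 < r) (j : Fin (r + 1)) :
    pqB (conjF (fun i => if i < l then κ i + 1 else κ i) B) r j =
      if (j : ℕ) < r + 1 - κ (l - 1) then pqA (conjF κ B) r j else pqB (conjF κ B) r j := by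
  have hM : κ (l - 1) ≤ κ 0 := hκ (Nat.zero_le _)
  have hj := j.2
  have hlt : ∀ c, c < l → κ (l - 1) ≤ κ c := fun c h => hκ (by omega)
  have hge : ∀ c, l ≤ c → κ c ≤ κ l := fun c h => hκ h
  have hκ' : Antitone (fun i => if i < l then κ i + 1 else κ i) := by
    intro x y hxy
    have h1 := hκ hxy
    simp only
    split_ifs <;> omega
  have h0' : ∀ i, B ≤ i → (fun i => if i < l then κ i + 1 else κ i) i = 0 := by
    intro i hi
    have := h0 i hi
    simp only
    rw [if_neg (by omega), this]
  have hkey : ∀ k, conjF (fun i => if i < l then κ i + 1 else κ i) B k =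
      if κ (l - 1) ≤ k then conjF κ B (k - 1) else conjF κ B k := by
    intro k
    apply pq_eq_of_lt
    intro c
    rw [pq_conj_lt hκ' h0']
    have h2 := hlt c
    have h3 := hge c
    split_ifs with h <;> rw [pq_conj_lt hκ h0] <;> omega
  unfold pqA pqB
  rw [hkey, show r - (j : ℕ) - 1 = r - 1 - j by omega]
  split_ifs <;> first | rfl | omega

end pqMain

lemma pq_asc_eq {P : Finset ℕ} {i : ℕ} (hi : i < P.card) :
    ascNth P i = (P.sort (· ≤ ·))[i]'(by simpa using hi) := by
  unfold ascNth
  rw [List.getD_eq_getElem]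

lemma pq_asc_mem {P : Finset ℕ} {i : ℕ} (hi : i < P.card) : ascNth P i ∈ P := by
  rw [pq_asc_eq hi]
  exact (Finset.mem_sort _).mp (List.getElem_mem _)

lemma pq_asc_lt {P : Finset ℕ} {i j : ℕ} (hij : i < j) (hj : j < P.card) :
    ascNth P i < ascNth P j := by
  rw [pq_asc_eq hj, pq_asc_eq (hij.trans hj)]
  exact (Finset.sortedLT_sort P).getElem_lt_getElem_of_lt hij

lemma pq_asc_surj {P : Finset ℕ} {x : ℕ} (hx : x ∈ P) : ∃ i, i < P.card ∧ ascNth P i = x := by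
  rw [← Finset.mem_sort (· ≤ ·), List.mem_iff_getElem] at hx
  obtain ⟨i, hi, h⟩ := hx
  have hi' : i < P.card := by simpa using hi
  exact ⟨i, hi', by rw [pq_asc_eq hi', h]⟩

lemma pq_sum_param {R ι : Type*} [AddCommMonoid R] [DecidableEq ι] (A C : Finset ℕ) (f g : ℕ → ι)
    (hf : Set.InjOn f A) (hg : Set.InjOn g C) (F : Finset (ι ⊕ ι) → R) :
    ∑ s ∈ ((A.image f).disjSum (C.image g)).powerset, F s =
      ∑ x ∈ A.powerset ×ˢ C.powerset, F ((x.1.image f).disjSum (x.2.image g)) := by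
  symm
  refine Finset.sum_nbij' (fun x => (x.1.image f).disjSum (x.2.image g))
    (fun s => (A.filter fun p => Sum.inl (f p) ∈ s, C.filter fun p => Sum.inr (g p) ∈ s))
    ?_ ?_ ?_ ?_ ?_
  · rintro ⟨P, Q⟩ h
    simp only [Finset.mem_product, Finset.mem_powerset] at h ⊢
    exact Finset.disjSum_mono (Finset.image_subset_image h.1) (Finset.image_subset_image h.2)
  · intro s hs
    simp [Finset.filter_subset]
  · rintro ⟨P, Q⟩ h
    simp only [Finset.mem_product, Finset.mem_powerset] at h
    ext x
    · simp only [Finset.inl_mem_disjSum, Finset.mem_image, Finset.mem_filter]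
      constructor
      · rintro ⟨h1, y, h2, h3⟩
        rwa [← hf (h.1 h2) h1 h3]
      · intro hx
        exact ⟨h.1 hx, x, hx, rfl⟩
    · simp only [Finset.inr_mem_disjSum, Finset.mem_image, Finset.mem_filter]
      constructor
      · rintro ⟨h1, y, h2, h3⟩
        rwa [← hg (h.2 h2) h1 h3]
      · intro hx
        exact ⟨h.2 hx, x, hx, rfl⟩
  · intro s hs
    rw [Finset.mem_powerset] at hs
    ext x
    rcases x with x | x
    · simp only [Finset.inl_mem_disjSum, Finset.mem_image, Finset.mem_filter]
      constructor
      · rintro ⟨y, ⟨h1, h2⟩, h3⟩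
        rwa [← h3]
      · intro hx
        have := hs hx
        simp only [Finset.inl_mem_disjSum, Finset.mem_image] at this
        obtain ⟨y, h1, h2⟩ := this
        exact ⟨y, ⟨h1, by rwa [h2]⟩, h2⟩
    · simp only [Finset.inr_mem_disjSum, Finset.mem_image, Finset.mem_filter]
      constructor
      · rintro ⟨y, ⟨h1, h2⟩, h3⟩
        rwa [← h3]
      · intro hx
        have := hs hx
        simp only [Finset.inr_mem_disjSum, Finset.mem_image] at this
        obtain ⟨y, h1, h2⟩ := this
        exact ⟨y, ⟨h1, by rwa [h2]⟩, h2⟩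
  · intro x _
    rfl

/-- Plücker-type quadratic relation for the ninth variation, dual version (Theorem 4.2(2)).
Here `stepPart n m rr` is the conjugate `λ'` of `λ`, and `λ = (λ')'`. -/
theorem plucker_quadratic_dual {R : Type*} [CommRing R] {N : ℕ} (hN : 0 < N)
    (U : Matrix (Fin N) (Fin N) R) (hU : UpperUni U)
    (n : ℕ) (hn : 1 ≤ n) (m rr : ℕ → ℕ)
    (hm : ∀ j, j + 1 < n → m (j + 1) < m j) (hmpos : 0 < m (n - 1))
    (hrr : ∀ j, j + 1 < n → rr j < rr (j + 1)) (hrrpos : 0 < rr 0)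
    (r : ℕ) (hr : m 0 + 1 ≤ r) (hrN : r + 1 ≤ N) (hwid : rr (n - 1) + 2 ≤ N - r)
    (d : ℕ) (hd1 : 1 ≤ d) (hdn : d ≤ n) :
    SchurV U r (conjF (stepPart n m rr) (rr (n - 1) + n)) (fun _ => 0) *
        SchurV U (r + 1) (conjF (stepPart n m rr) (rr (n - 1) + n)) (fun _ => 0) =
      SchurV U r
          (conjF
            (fun i => if i < rr (d - 1) then stepPart n m rr i - 1 else stepPart n m rr i)
            (rr (n - 1) + n))
          (fun _ => 0) *
        SchurV U (r + 1)
          (conjF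
            (fun i => if i < rr (d - 1) then stepPart n m rr i + 1 else stepPart n m rr i)
            (rr (n - 1) + n))
          (fun _ => 0) +
      ∑ t ∈ Finset.Icc 1 (min d (n - d + 1)),
        (-1 : R) ^ (t - 1) *
          ∑ P ∈ Finset.powersetCard t (Finset.Icc 1 d),
            ∑ Q ∈ Finset.powersetCard t (Finset.Icc d n),
              SchurV U r
                  (conjF
                    (iterOp AddOp t (fun i => rr (ascNth P i - 1))
                      (fun i => rr (ascNth Q (t - 1 - i) - 1)) (stepPart n m rr))
                    (rr (n - 1) + n))
                  (fun _ => 0) *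
                SchurV U (r + 1)
                  (conjF
                    (iterOp RemOp t (fun i => rr (ascNth P i - 1))
                      (fun i => rr (ascNth Q (t - 1 - i) - 1)) (stepPart n m rr))
                    (rr (n - 1) + n))
                  (fun _ => 0) := by
  classical
  set κ := stepPart n m rr with hκdef
  set B := rr (n - 1) + n with hB
  have hκ : Antitone κ := pq_step_antitone hn hm hrr
  have h0 : ∀ i, B ≤ i → κ i = 0 := fun i hi => pq_step_zero hrr (by omega)
  have hκ0 : κ 0 = m 0 := pq_step_eq (by omega) hrrpos (fun k hk => by omega)
  have hr' : κ 0 < r := by omega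
  have hmle : ∀ j, j < n → m j ≤ m 0 := by
    intro j hj
    rcases Nat.eq_zero_or_pos j with h | h
    · rw [h]
    · exact (pq_strict_m hm j 0 h hj).le
  have htop : ∀ j, j < n → κ (rr j - 1) = m j := fun j hj => pq_step_top hrr hrrpos hj
  have hcor : ∀ j, j < n → κ (rr j) < κ (rr j - 1) := fun j hj =>
    pq_step_corner hm hmpos hrr hrrpos hj
  have hrrpos' : ∀ j, j < n → 1 ≤ rr j := fun j hj => pq_rr_pos hrr hrrpos hj
  have hmpos' : ∀ j, j < n → 0 < m j := fun j hj => pq_m_pos hm hmpos hj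
  have hrrle : ∀ i j, i ≤ j → j < n → rr i ≤ rr j := by
    intro i j hij hj
    rcases Nat.lt_or_eq_of_le hij with h | h
    · exact (pq_strict_rr hrr j i h hj).le
    · rw [h]
  have hmanti : ∀ i j, i ≤ j → j < n → m j ≤ m i := by
    intro i j hij hj
    rcases Nat.lt_or_eq_of_le hij with h | h
    · exact (pq_strict_m hm j i h hj).le
    · rw [h]
  set M := m (d - 1) with hM
  have hMtop : κ (rr (d - 1) - 1) = M := htop _ (by omega)
  have hMr : M ≤ m 0 := hmle _ (by omega)
  have hMpos : 0 < M := hmpos' _ (by omega)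
  let a : Fin (r + 1) → Fin (r + 1) → R := fun j => pqCol U r (pqA (conjF κ B) r j)
  let b : Fin (r + 1) → Fin (r + 1) → R := fun j => pqCol U r (pqB (conjF κ B) r j)
  let K : Fin (r + 1) → Prop := fun j => (j : ℕ) < r + 1 - M
  let F : Finset (Fin (r + 1) ⊕ Fin (r + 1)) → R := fun s =>
    (of (s.piecewise (pqMove a b) (pqStay a b))).det
  let fP : ℕ → Fin (r + 1) := fun p => ⟨r - κ (rr (p - 1) - 1), by omega⟩
  let fQ : ℕ → Fin (r + 1) := fun q => ⟨r - κ (rr (q - 1)), by omega⟩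
  have hfP : ∀ p, (fP p : ℕ) = r - κ (rr (p - 1) - 1) := fun _ => rfl
  have hfQ : ∀ p, (fQ p : ℕ) = r - κ (rr (p - 1)) := fun _ => rfl
  have hexp := pq_expand a b K
  have hmain : SchurV U r (conjF (fun i => if i < rr (d - 1) then κ i - 1 else κ i) B)
        (fun _ => 0) *
      SchurV U (r + 1) (conjF (fun i => if i < rr (d - 1) then κ i + 1 else κ i) B)
        (fun _ => 0) = ∑ s ∈ (pqSet K).powerset, F s := by
    rw [hexp, mul_comm, pq_schur_b, pq_schur_a]
    have hlB : rr (d - 1) ≤ B := by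
      have := hrrle (d - 1) (n - 1) (by omega) (by omega)
      omega
    unfold pqD
    congr 2
    · congr 1
      funext j
      rw [pqB_plus hκ h0 (hcor _ (by omega)) hlB hr', hMtop]
      by_cases hK : (j : ℕ) < r + 1 - M
      · simp only [K, if_pos hK, a]
      · simp only [K, if_neg hK, b]
    · congr 1
      funext j
      rw [pqA_minus hκ h0 (hcor _ (by omega)) hr', hMtop]
      by_cases hK : (j : ℕ) < r + 1 - M
      · simp only [K, if_pos hK, b]
      · simp only [K, if_neg hK, a]
  have hform : ∀ j : Fin (r + 1), a j ≠ b j → (j : ℕ) < r →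
      ∃ j', j' < n ∧ (j : ℕ) = r - m j' := by
    intro j hab hjr
    by_contra hcon
    push Not at hcon
    apply hab
    simp only [a, b, pqA, pqB, if_pos hjr]
    have : conjF κ B (r - 1 - (j : ℕ)) = conjF κ B (r - (j : ℕ)) := by
      apply pq_eq_of_lt
      intro c
      rw [pq_conj_lt hκ h0, pq_conj_lt hκ h0]
      constructor
      · intro h
        by_contra h'
        have hc : c < rr (n - 1) := by
          by_contra hc
          have : κ c = 0 := pq_step_zero hrr (by omega)
          omega
        obtain ⟨j', h1, -, -, h2⟩ := pq_step_form (m := m) hn hc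
        have := hcon j' h1
        have h3 : κ c = m j' := h2
        omega
      · intro h; omega
    rw [this]
  have hKP : ∀ j : Fin (r + 1), a j ≠ b j → K j → ∃ p ∈ Finset.Icc 1 d, fP p = j := by
    intro j hab hK
    simp only [K] at hK
    obtain ⟨j', h1, h2⟩ := hform j hab (by omega)
    have h3 := hmle j' h1
    have h4 : j' ≤ d - 1 := by
      by_contra h4
      have := pq_strict_m hm j' (d - 1) (by omega) h1
      omega
    refine ⟨j' + 1, by rw [Finset.mem_Icc]; omega, ?_⟩
    apply Fin.ext
    rw [hfP, Nat.add_sub_cancel, htop _ h1, h2]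
  have hKQ : ∀ j : Fin (r + 1), a j ≠ b j → ¬ K j → ∃ p ∈ Finset.Icc d n, fQ p = j := by
    intro j hab hK
    simp only [K] at hK
    by_cases hjr : (j : ℕ) < r
    · obtain ⟨j', h1, h2⟩ := hform j hab hjr
      have h3 := hmle j' h1
      have h4 : d - 1 < j' := by
        by_contra h4
        have := hmanti j' (d - 1) (by omega) (by omega)
        omega
      refine ⟨j', by rw [Finset.mem_Icc]; omega, ?_⟩
      apply Fin.ext
      rw [hfQ, h2]
      have h5 : κ (rr (j' - 1)) = m (j' - 1 + 1) := pq_step_bot hrr (by omega)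
      rw [h5, show j' - 1 + 1 = j' by omega]
    · refine ⟨n, by rw [Finset.mem_Icc]; omega, ?_⟩
      apply Fin.ext
      have h5 : κ (rr (n - 1)) = 0 := pq_step_zero hrr le_rfl
      have := j.2
      rw [hfQ, h5]
      omega
  have hPK : ∀ p ∈ Finset.Icc 1 d, K (fP p) := by
    intro p hp
    rw [Finset.mem_Icc] at hp
    simp only [K, hfP]
    rw [htop _ (by omega)]
    have := hmanti (p - 1) (d - 1) (by omega) (by omega)
    have := hmle (p - 1) (by omega)
    omega
  have hQK : ∀ q ∈ Finset.Icc d n, ¬ K (fQ q) := by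
    intro q hq
    rw [Finset.mem_Icc] at hq
    simp only [K, hfQ]
    have h1 := hcor (q - 1) (by omega)
    rw [htop _ (by omega)] at h1
    have := hmanti (d - 1) (q - 1) (by omega) (by omega)
    omega
  have hPinj : Set.InjOn fP (Finset.Icc 1 d : Finset ℕ) := by
    have key : ∀ x y, 1 ≤ x → x < y → y ≤ d → fP x ≠ fP y := by
      intro x y hx hxy hy h
      have h := congrArg Fin.val h
      rw [hfP, hfP, htop _ (by omega), htop _ (by omega)] at h
      have := pq_strict_m hm (y - 1) (x - 1) (by omega) (by omega)
      have := hmle (x - 1) (by omega)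
      omega
    intro x hx y hy h
    rw [Finset.mem_coe, Finset.mem_Icc] at hx hy
    rcases lt_trichotomy x y with h' | h' | h'
    · exact absurd h (key x y hx.1 h' hy.2)
    · exact h'
    · exact absurd h.symm (key y x hy.1 h' hx.2)
  have hQinj : Set.InjOn fQ (Finset.Icc d n : Finset ℕ) := by
    have key : ∀ x y, d ≤ x → x < y → y ≤ n → fQ x ≠ fQ y := by
      intro x y hx hxy hy h
      have h := congrArg Fin.val h
      rw [hfQ, hfQ] at h
      have h1 := hcor (y - 1) (by omega)
      have h2 := pq_strict_rr hrr (y - 1) (x - 1) (by omega) (by omega)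
      have h3 := hκ (show rr (x - 1) ≤ rr (y - 1) - 1 by omega)
      have h4 : κ (rr (x - 1)) ≤ κ 0 := hκ (Nat.zero_le _)
      omega
    intro x hx y hy h
    rw [Finset.mem_coe, Finset.mem_Icc] at hx hy
    rcases lt_trichotomy x y with h' | h' | h'
    · exact absurd h (key x y hx.1 h' hy.2)
    · exact h'
    · exact absurd h.symm (key y x hy.1 h' hx.2)
  have hsum1 : ∑ s ∈ (pqSet K).powerset, F s =
      ∑ s ∈ (((Finset.Icc 1 d).image fP).disjSum ((Finset.Icc d n).image fQ)).powerset, F s := by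
    symm
    apply Finset.sum_subset
    · apply Finset.powerset_mono.mpr
      unfold pqSet
      apply Finset.disjSum_mono
      · intro x hx
        rw [Finset.mem_image] at hx
        obtain ⟨p, hp, rfl⟩ := hx
        simp [hPK p hp]
      · intro x hx
        rw [Finset.mem_image] at hx
        obtain ⟨p, hp, rfl⟩ := hx
        simp [hQK p hp]
    · intro s hs hns
      rw [Finset.mem_powerset] at hs hns
      rw [Finset.not_subset] at hns
      obtain ⟨x, hx, hxn⟩ := hns
      have hinl : ∀ j, Sum.inl j ∈ s → K j := by
        intro j hj
        have := hs hj
        simpa [pqSet] using this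
      have hinr : ∀ j, Sum.inr j ∈ s → ¬ K j := by
        intro j hj
        have := hs hj
        simpa [pqSet] using this
      rcases x with j | j
      · have hK := hinl j hx
        apply pq_zero_common a b s j
        · by_contra hne
          obtain ⟨p, hp, h⟩ := hKP j hne hK
          exact hxn (by rw [Finset.inl_mem_disjSum]; exact Finset.mem_image.mpr ⟨p, hp, h⟩)
        · exact Or.inl ⟨hx, fun h => hinr j h hK⟩
      · have hK := hinr j hx
        apply pq_zero_common a b s j
        · by_contra hne
          obtain ⟨p, hp, h⟩ := hKQ j hne hK
          exact hxn (by rw [Finset.inr_mem_disjSum]; exact Finset.mem_image.mpr ⟨p, hp, h⟩)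
        · exact Or.inr ⟨fun h => hK (hinl j h), hx⟩
  have hterm : ∀ t, ∀ P ∈ Finset.powersetCard t (Finset.Icc 1 d),
      ∀ Q ∈ Finset.powersetCard t (Finset.Icc d n),
      F ((P.image fP).disjSum (Q.image fQ)) = (-1) ^ t *
        (SchurV U r (conjF (iterOp AddOp t (fun i => rr (ascNth P i - 1))
            (fun i => rr (ascNth Q (t - 1 - i) - 1)) κ) B) (fun _ => 0) *
          SchurV U (r + 1) (conjF (iterOp RemOp t (fun i => rr (ascNth P i - 1))
            (fun i => rr (ascNth Q (t - 1 - i) - 1)) κ) B) (fun _ => 0)) := by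
    intro t P hP Q hQ
    rw [Finset.mem_powersetCard] at hP hQ
    obtain ⟨hPs, hPc⟩ := hP
    obtain ⟨hQs, hQc⟩ := hQ
    have hPm : ∀ i, i < t → 1 ≤ ascNth P i ∧ ascNth P i ≤ d := fun i hi =>
      Finset.mem_Icc.mp (hPs (pq_asc_mem (by omega)))
    have hQm : ∀ i, i < t → d ≤ ascNth Q (t - 1 - i) ∧ ascNth Q (t - 1 - i) ≤ n := fun i hi =>
      Finset.mem_Icc.mp (hQs (pq_asc_mem (by omega)))
    have hset : (P.image fP).disjSum (Q.image fQ) =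
        pqS t (fun i => fP (ascNth P i)) (fun i => fQ (ascNth Q (t - 1 - i))) := by
      unfold pqS
      congr 1
      · ext x
        simp only [Finset.mem_image, Finset.mem_range]
        constructor
        · rintro ⟨p, hp, rfl⟩
          obtain ⟨i, hi, rfl⟩ := pq_asc_surj hp
          exact ⟨i, by omega, rfl⟩
        · rintro ⟨i, hi, rfl⟩
          exact ⟨_, pq_asc_mem (by omega), rfl⟩
      · ext x
        simp only [Finset.mem_image, Finset.mem_range]
        constructor
        · rintro ⟨p, hp, rfl⟩
          obtain ⟨i, hi, rfl⟩ := pq_asc_surj hp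
          exact ⟨t - 1 - i, by omega, by rw [show t - 1 - (t - 1 - i) = i by omega]⟩
        · rintro ⟨i, hi, rfl⟩
          exact ⟨_, pq_asc_mem (by omega), rfl⟩
    rw [hset]
    apply pq_term U hκ h0 hr'
    · intro i hi
      exact hrrpos' _ (by have := hPm i hi; omega)
    · intro i hi
      have h1 := hPm i hi
      have h2 := hQm i hi
      exact hrrle _ _ (by omega) (by omega)
    · intro i hi
      exact hcor _ (by have := hPm i hi; omega)
    · intro i hi
      exact hcor _ (by have := hQm i hi; omega)
    · intro i hi
      have h2 := hQm i hi
      have := hrrle (ascNth Q (t - 1 - i) - 1) (n - 1) (by omega) (by omega)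
      omega
    · intro i j hij hj
      have h1 := hPm i (by omega)
      have h2 := hPm j hj
      have h3 : ascNth P i < ascNth P j := pq_asc_lt hij (by omega)
      exact pq_strict_rr hrr _ _ (by omega) (by omega)
    · intro i j hij hj
      have h1 := hQm i (by omega)
      have h2 := hQm j hj
      have h3 : ascNth Q (t - 1 - j) < ascNth Q (t - 1 - i) := pq_asc_lt (by omega) (by omega)
      exact pq_strict_rr hrr _ _ (by omega) (by omega)
    · intro i hi
      rfl
    · intro i hi
      rfl
  have hsum2 : ∑ s ∈ (pqSet K).powerset, F s =
      ∑ t ∈ Finset.range (d + 1), ∑ P ∈ Finset.powersetCard t (Finset.Icc 1 d),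
        ∑ Q ∈ Finset.powersetCard t (Finset.Icc d n),
          F ((P.image fP).disjSum (Q.image fQ)) := by
    rw [hsum1, pq_sum_param _ _ _ _ hPinj hQinj, Finset.sum_product, Finset.sum_powerset,
      Nat.card_Icc, Nat.add_sub_cancel]
    apply Finset.sum_congr rfl
    intro t _
    apply Finset.sum_congr rfl
    intro P hP
    rw [Finset.mem_powersetCard] at hP
    symm
    apply Finset.sum_subset
    · intro Q hQ
      rw [Finset.mem_powersetCard] at hQ
      exact Finset.mem_powerset.mpr hQ.1
    · intro Q hQ hQn
      rw [Finset.mem_powerset] at hQ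
      rw [Finset.mem_powersetCard] at hQn
      apply pq_zero_card
      rw [Finset.card_image_of_injOn (hPinj.mono (by exact_mod_cast hP.1)),
        Finset.card_image_of_injOn (hQinj.mono (by exact_mod_cast hQ)), hP.2]
      intro h
      exact hQn ⟨hQ, h.symm⟩
  have hrange : Finset.range (d + 1) = insert 0 (Finset.Icc 1 d) := by
    ext x
    simp only [Finset.mem_range, Finset.mem_insert, Finset.mem_Icc]
    omega
  rw [hmain, hsum2, hrange, Finset.sum_insert (by simp)]
  have hzero : ∑ P ∈ Finset.powersetCard 0 (Finset.Icc 1 d),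
        ∑ Q ∈ Finset.powersetCard 0 (Finset.Icc d n),
          F ((P.image fP).disjSum (Q.image fQ)) =
      SchurV U r (conjF κ B) (fun _ => 0) * SchurV U (r + 1) (conjF κ B) (fun _ => 0) := by
    rw [Finset.powersetCard_zero, Finset.powersetCard_zero, Finset.sum_singleton,
      Finset.sum_singleton, hterm 0 ∅ (by simp) ∅ (by simp)]
    simp [iterOp]
  rw [hzero]
  have hIcc : ∀ G : ℕ → R, (∀ t, n - d + 1 < t → G t = 0) →
      ∑ t ∈ Finset.Icc 1 (min d (n - d + 1)), G t = ∑ t ∈ Finset.Icc 1 d, G t := by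
    intro G hG
    apply Finset.sum_subset
    · intro x hx
      rw [Finset.mem_Icc] at hx ⊢
      omega
    · intro x hx hxn
      rw [Finset.mem_Icc] at hx hxn
      exact hG x (by omega)
  rw [hIcc, add_assoc, ← Finset.sum_add_distrib, left_eq_add]
  · apply Finset.sum_eq_zero
    intro t ht
    rw [Finset.mem_Icc] at ht
    rw [Finset.mul_sum, ← Finset.sum_add_distrib]
    apply Finset.sum_eq_zero
    intro P hP
    rw [Finset.mul_sum, ← Finset.sum_add_distrib]
    apply Finset.sum_eq_zero
    intro Q hQ
    rw [hterm t P hP Q hQ]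
    obtain ⟨t', rfl⟩ : ∃ t', t = t' + 1 := ⟨t - 1, by omega⟩
    rw [pow_succ, Nat.add_sub_cancel]
    ring
  · intro t ht
    have : Finset.powersetCard t (Finset.Icc d n) = ∅ := by
      apply Finset.powersetCard_eq_empty.mpr
      rw [Nat.card_Icc]
      omega
    rw [this]
    simp
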